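/- Let m ≥ 2 and n ≥ i_1 > i_2 > … > i_{m−1} > 0 be integers, and let (B_1, …, B_{m−1}, B_m) be an ordered decomposition of {1,…,N}. Then in F = ℚ(z_1,…,z_N) one has s_{((i_1−m+1)^{|B_1|}, (i_2−m+2)^{|B_2|}, …, (i_{m−1}+1)^{|B_{m−1}|})}(z_1,…,z_N) = Σ over all ordered decompositions (C′, C) of {1,…,N} with |C| = |B_m| of [1/(z_{C′} − z_C)] · s_{((i_1−m+1+|B_m|)^{|B_1|}, (i_2−m+2+|B_m|)^{|B_2|}, …, (i_{m−1}+1+|B_m|)^{|B_{m−1}|})}(z_{C′}), where on the left the partition is padded with |B_m| zeros to length N. -/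

import Mathlib

open scoped BigOperators

noncomputable section

/-- `F N` is the field `ℚ(z_1, …, z_N)` of rational functions in `N` variables. -/
abbrev F (N : ℕ) := FractionRing (MvPolynomial (Fin N) ℚ)

/-- The variable `z_a` viewed inside `F N`. -/
noncomputable def z {N : ℕ} (a : Fin N) : F N :=
  algebraMap (MvPolynomial (Fin N) ℚ) (F N) (MvPolynomial.X a)

/-- `z_A^p := ∏_{a ∈ A} z_a^p`. -/
noncomputable def zpowProd {N : ℕ} (A : Finset (Fin N)) (p : ℤ) : F N :=
  ∏ a ∈ A, z a ^ p

/-- `1 − z_A/z_B := ∏_{a∈A} ∏_{b∈B} (1 − z_a/z_b)`. -/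
noncomputable def oneSub {N : ℕ} (A B : Finset (Fin N)) : F N :=
  ∏ a ∈ A, ∏ b ∈ B, (1 - z a / z b)

/-- `z_A − z_B := ∏_{a∈A} ∏_{b∈B} (z_a − z_b)`. -/
noncomputable def zsub {N : ℕ} (A B : Finset (Fin N)) : F N :=
  ∏ a ∈ A, ∏ b ∈ B, (z a - z b)

/-- Read an exponent sequence off a list, padding with `0`. -/
def padded (L : List ℤ) : ℕ → ℤ := fun t => L.getD t 0

/-- The Schur polynomial (bialternant form) associated with the index set
`A ⊆ {1,…,N}` (with its increasing enumeration) and the exponent sequence `lam`. -/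
noncomputable def schur {N : ℕ} (A : Finset (Fin N)) (lam : ℕ → ℤ) : F N :=
  Matrix.det (Matrix.of fun i j : Fin A.card =>
      z ((A.orderIsoOfFin rfl i : Fin N)) ^ (lam j + (A.card : ℤ) - 1 - (j : ℤ)))
    / Matrix.det (Matrix.of fun i j : Fin A.card =>
      z ((A.orderIsoOfFin rfl i : Fin N)) ^ ((A.card : ℤ) - 1 - (j : ℤ)))


/-- The determinant of the Vandermonde matrix with decreasing exponents. -/
theorem det_pow_rev {K : Type*} [Field K] {n : ℕ} (w : Fin n → K) :
    Matrix.det (Matrix.of fun i j : Fin n => w i ^ ((n : ℤ) - 1 - (j : ℤ)))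
      = ∏ i, ∏ j ∈ Finset.Ioi i, (w i - w j) := by
  have h := Matrix.det_projVandermonde (fun _ : Fin n => (1 : K)) w
  simp only [one_mul] at h
  rw [← h]
  congr 1
  ext i j
  have hj : (n : ℤ) - 1 - (j : ℤ) = ((Fin.rev j : ℕ) : ℤ) := by
    rw [Fin.val_rev]
    omega
  rw [Matrix.of_apply, hj, zpow_natCast]
  simp [Matrix.projVandermonde_apply]

/-- The product of differences over a concatenation of two tuples. -/
theorem prod_Ioi_sub_add {K : Type*} [Field K] {M k : ℕ} (w : Fin (M + k) → K) :
    ∏ i, ∏ j ∈ Finset.Ioi i, (w i - w j)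
      = (∏ i, ∏ j, (w (Fin.castAdd k i) - w (Fin.natAdd M j))) *
        (∏ i, ∏ j ∈ Finset.Ioi i, (w (Fin.castAdd k i) - w (Fin.castAdd k j))) *
        ∏ i, ∏ j ∈ Finset.Ioi i, (w (Fin.natAdd M i) - w (Fin.natAdd M j)) := by
  have hIoi : ∀ (n : ℕ) (i : Fin n) (f : Fin n → K),
      ∏ j ∈ Finset.Ioi i, f j = ∏ j, if i < j then f j else 1 := by
    intro n i f
    rw [← Finset.prod_filter]
    congr 1
    ext j
    simp
  simp only [hIoi, Fin.prod_univ_add]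
  have h1 : ∀ (i : Fin M) (j : Fin k), Fin.castAdd k i < Fin.natAdd M j := by
    intro i j
    simp only [Fin.lt_def, Fin.val_castAdd, Fin.val_natAdd]
    omega
  have h2 : ∀ (i : Fin M) (j : Fin k), ¬ Fin.natAdd M j < Fin.castAdd k i := by
    intro i j
    exact not_lt_of_gt (h1 i j)
  have h3 : ∀ i j : Fin M, Fin.castAdd k i < Fin.castAdd k j ↔ i < j :=
    fun _ _ => Iff.rfl
  have h4 : ∀ i j : Fin k, Fin.natAdd M i < Fin.natAdd M j ↔ i < j :=
    fun i j => Fin.natAdd_lt_natAdd_iff M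
  simp only [h1, h2, h3, h4, if_true, if_false, Finset.prod_const_one, one_mul,
    Finset.prod_mul_distrib]
  ring

/-- Laplace expansion: a determinant is the sum over row subsets `S` of size `M` of the
determinants of the matrix masked to `S` on the first `M` columns and to `Sᶜ` on the others. -/
theorem det_eq_sum_masked {R : Type*} [CommRing R] {M k : ℕ}
    (A : Matrix (Fin (M + k)) (Fin (M + k)) R) :
    A.det = ∑ S ∈ Finset.powersetCard M (Finset.univ : Finset (Fin (M + k))),
      Matrix.det (Matrix.of fun a j : Fin (M + k) =>
        if (a ∈ S ↔ (j : ℕ) < M) then A a j else 0) := by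
  simp only [Matrix.det_apply, Matrix.of_apply]
  rw [Finset.sum_comm]
  refine Finset.sum_congr rfl fun σ _ => ?_
  rw [← Finset.smul_sum]
  congr 1
  set S₀ : Finset (Fin (M + k)) := Finset.univ.map
    ((Fin.castAddEmb k).trans σ.toEmbedding) with hS₀
  have hmem : ∀ j, σ j ∈ S₀ ↔ (j : ℕ) < M := by
    intro j
    simp only [hS₀, Finset.mem_map, Finset.mem_univ, true_and]
    constructor
    · rintro ⟨x, hx⟩
      have : Fin.castAdd k x = j := σ.injective hx
      rw [← this]
      exact x.isLt
    · intro h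
      exact ⟨⟨j, h⟩, rfl⟩
  rw [Finset.sum_eq_single S₀]
  · refine Finset.prod_congr rfl fun j _ => ?_
    rw [if_pos (hmem j)]
  · intro S _ hne
    by_contra h0
    refine hne ?_
    ext a
    obtain ⟨j, rfl⟩ := σ.surjective a
    rw [hmem]
    by_contra hj
    exact h0 (Finset.prod_eq_zero (Finset.mem_univ j) (if_neg hj))
  · intro h
    refine absurd ?_ h
    simp [Finset.mem_powersetCard, hS₀]

/-- Reordering rows does not change the quotient of two determinants. -/
theorem det_div_det_submatrix {K ι κ : Type*} [Field K] [Fintype ι] [DecidableEq ι]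
    [Fintype κ] [DecidableEq κ] (A V : Matrix ι ι K) (e c : κ ≃ ι) :
    (A.submatrix e c).det / (V.submatrix e c).det = A.det / V.det := by
  have h : ∀ X : Matrix ι ι K, (X.submatrix e c).det
      = ((Equiv.Perm.sign (c.symm.trans e) : ℤ) : K) * X.det := by
    intro X
    rw [← Matrix.det_permute, ← Matrix.det_submatrix_equiv_self c]
    congr 1
    ext i j
    simp
  rw [h, h]
  refine mul_div_mul_left _ _ ?_
  rcases Int.units_eq_one_or (Equiv.Perm.sign (c.symm.trans e)) with h | h <;> simp [h]

theorem z_injective {N : ℕ} : Function.Injective (z : Fin N → F N) :=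
  (IsFractionRing.injective (MvPolynomial (Fin N) ℚ) (F N)).comp (MvPolynomial.X_injective)

/-- The Schur quotient, with the cardinality of the index set replaced by an equal number. -/
theorem schur_eq_of_card {N M : ℕ} (A : Finset (Fin N)) (hA : A.card = M) (lam : ℕ → ℤ) :
    schur A lam = Matrix.det (Matrix.of fun i j : Fin M =>
        z (A.orderEmbOfFin hA i) ^ (lam j + (M : ℤ) - 1 - (j : ℤ)))
      / ∏ i, ∏ j ∈ Finset.Ioi i, (z (A.orderEmbOfFin hA i) - z (A.orderEmbOfFin hA j)) := by
  subst hA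
  rw [← det_pow_rev]
  rfl

theorem schur_univ {N : ℕ} (lam : ℕ → ℤ) :
    schur (Finset.univ : Finset (Fin N)) lam = Matrix.det (Matrix.of fun i j : Fin N =>
        z i ^ (lam j + (N : ℤ) - 1 - (j : ℤ)))
      / Matrix.det (Matrix.of fun i j : Fin N => z i ^ ((N : ℤ) - 1 - (j : ℤ))) := by
  have h : ∀ i, (Finset.univ : Finset (Fin N)).orderEmbOfFin (Finset.card_fin N) i = i := by
    intro i
    have := Finset.orderEmbOfFin_unique (Finset.card_fin N) (f := id)
      (fun _ => Finset.mem_univ _) strictMono_id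
    exact (congrFun this i).symm
  rw [schur_eq_of_card _ (Finset.card_fin N), det_pow_rev]
  simp only [h]

/-- The contribution of a single row subset to the expansion of a Schur polynomial. -/
theorem det_masked_div {M k : ℕ} (l l' : ℕ → ℤ) (h1 : ∀ j < M, l' j = l j + k)
    (h2 : ∀ j, M ≤ j → l j = 0) (S : Finset (Fin (M + k))) (hS : S.card = M) :
    Matrix.det (Matrix.of fun a j : Fin (M + k) =>
        if (a ∈ S ↔ (j : ℕ) < M) then
          (z a : F (M + k)) ^ (l j + ((M + k : ℕ) : ℤ) - 1 - (j : ℤ)) else 0)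
      / Matrix.det (Matrix.of fun a j : Fin (M + k) =>
          (z a : F (M + k)) ^ (((M + k : ℕ) : ℤ) - 1 - (j : ℤ)))
      = (zsub S Sᶜ)⁻¹ * schur S l' := by
  have hSc : Sᶜ.card = k := by
    rw [Finset.card_compl, hS, Fintype.card_fin]
    omega
  set e : Fin M ⊕ Fin k ≃ Fin (M + k) := finSumEquivOfFinset hS hSc
  have hel : ∀ i, e (Sum.inl i) = S.orderEmbOfFin hS i := fun i =>
    finSumEquivOfFinset_inl hS hSc i
  have her : ∀ i, e (Sum.inr i) = Sᶜ.orderEmbOfFin hSc i := fun i =>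
    finSumEquivOfFinset_inr hS hSc i
  have hmS : ∀ i, e (Sum.inl i) ∈ S := fun i => by
    rw [hel]
    exact Finset.orderEmbOfFin_mem _ _ _
  have hmSc : ∀ i, e (Sum.inr i) ∉ S := fun i => by
    rw [her, ← Finset.mem_compl]
    exact Finset.orderEmbOfFin_mem _ _ _
  rw [← det_div_det_submatrix _ _ e finSumFinEquiv]
  have hnum : (Matrix.of fun a j : Fin (M + k) => if (a ∈ S ↔ (j : ℕ) < M) then
          (z a : F (M + k)) ^ (l j + ((M + k : ℕ) : ℤ) - 1 - (j : ℤ)) else 0).submatrix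
          e finSumFinEquiv
      = Matrix.fromBlocks
        (Matrix.of fun i j : Fin M =>
          z (S.orderEmbOfFin hS i) ^ (l' j + (M : ℤ) - 1 - (j : ℤ))) 0 0
        (Matrix.of fun i j : Fin k =>
          z (Sᶜ.orderEmbOfFin hSc i) ^ ((k : ℤ) - 1 - (j : ℤ))) := by
    ext a j
    rcases a with a | a <;> rcases j with j | j
    · simp only [Matrix.submatrix_apply, Matrix.of_apply, Matrix.fromBlocks_apply₁₁,
        finSumFinEquiv_apply_left, Fin.val_castAdd, h1 j j.isLt]
      rw [if_pos (iff_of_true (hmS a) j.isLt), hel]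
      congr 1
      push_cast
      ring
    · simp [hmS]
    · simp [hmSc]
    · simp only [Matrix.submatrix_apply, Matrix.of_apply, Matrix.fromBlocks_apply₂₂,
        finSumFinEquiv_apply_right, Fin.val_natAdd, h2 _ (Nat.le_add_right M j)]
      rw [if_pos (iff_of_false (hmSc a) (by omega)), her]
      congr 1
      push_cast
      ring
  have hden : ((Matrix.of fun a j : Fin (M + k) =>
          (z a : F (M + k)) ^ (((M + k : ℕ) : ℤ) - 1 - (j : ℤ))).submatrix
          e finSumFinEquiv).det
      = zsub S Sᶜ *
        (∏ i, ∏ j ∈ Finset.Ioi i, (z (S.orderEmbOfFin hS i) - z (S.orderEmbOfFin hS j))) *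
        ∏ i, ∏ j ∈ Finset.Ioi i,
          (z (Sᶜ.orderEmbOfFin hSc i) - z (Sᶜ.orderEmbOfFin hSc j)) := by
    have hw := det_pow_rev fun i : Fin (M + k) => (z (e (finSumFinEquiv.symm i)) : F (M + k))
    rw [prod_Ioi_sub_add] at hw
    simp only [finSumFinEquiv_symm_apply_castAdd, finSumFinEquiv_symm_apply_natAdd,
      hel, her] at hw
    have hz : zsub S Sᶜ = ∏ i, ∏ j,
        ((z (S.orderEmbOfFin hS i) : F (M + k)) - z (Sᶜ.orderEmbOfFin hSc j)) := by
      have hprod : ∀ {n : ℕ} (T : Finset (Fin (M + k))) (hT : T.card = n)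
          (f : Fin (M + k) → F (M + k)), ∏ a ∈ T, f a = ∏ i, f (T.orderEmbOfFin hT i) := by
        intro n T hT f
        conv_lhs => rw [← Finset.image_orderEmbOfFin_univ T hT]
        rw [Finset.prod_image fun _ _ _ _ h => (T.orderEmbOfFin hT).injective h]
      simp only [zsub, hprod S hS, hprod Sᶜ hSc]
    rw [hz, ← hw, ← Matrix.det_submatrix_equiv_self finSumFinEquiv]
    congr 1
    ext i j
    simp
  have hV : ∏ i, ∏ j ∈ Finset.Ioi i,
      ((z (Sᶜ.orderEmbOfFin hSc i) : F (M + k)) - z (Sᶜ.orderEmbOfFin hSc j)) ≠ 0 := by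
    refine Finset.prod_ne_zero_iff.2 fun i _ => Finset.prod_ne_zero_iff.2 fun j hj => ?_
    refine sub_ne_zero.2 fun h => ?_
    exact (Finset.mem_Ioi.1 hj).ne ((Sᶜ.orderEmbOfFin hSc).injective (z_injective h))
  rw [hnum, hden, Matrix.det_fromBlocks_zero₂₁, det_pow_rev, mul_div_mul_right _ _ hV,
    schur_eq_of_card S hS, div_eq_mul_inv, div_eq_mul_inv, mul_inv]
  ring

/-- Expansion of the Schur polynomial of a sequence vanishing from position `M` on. -/
theorem schur_univ_eq_sum {N M k : ℕ} (hN : M + k = N) (l l' : ℕ → ℤ)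
    (h1 : ∀ j < M, l' j = l j + k) (h2 : ∀ j, M ≤ j → l j = 0) :
    schur (Finset.univ : Finset (Fin N)) l
      = ∑ S ∈ Finset.powersetCard M (Finset.univ : Finset (Fin N)),
          (zsub S Sᶜ)⁻¹ * schur S l' := by
  subst hN
  rw [schur_univ, det_eq_sum_masked, Finset.sum_div]
  refine Finset.sum_congr rfl fun S hS => ?_
  exact det_masked_div l l' h1 h2 S (Finset.mem_powersetCard.1 hS).2

open Classical in
/-- the Gustafson–Milne-type identity with the last block frozen at `0`.
Here `i j` denotes `i_{j+1}` for `j : Fin (m-1)`, so that `n ≥ i_1 > ⋯ > i_{m-1} > 0`. -/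
theorem statement7 (N n m : ℕ) (hm : 2 ≤ m)
    (i : Fin (m - 1) → ℕ) (hanti : StrictAnti i) (hn : ∀ j, i j ≤ n)
    (hpos : ∀ j, 0 < i j)
    (B : Fin m → Finset (Fin N))
    (hdisj : ∀ j k, j ≠ k → Disjoint (B j) (B k))
    (hcover : Finset.univ.biUnion B = Finset.univ) :
    schur (Finset.univ : Finset (Fin N))
        (padded (List.ofFn fun j : Fin (m - 1) =>
          List.replicate (B ⟨(j : ℕ), by have := j.isLt; omega⟩).card
            ((i j : ℤ) - m + 1 + (j : ℤ))).flatten)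
      = ∑ P ∈ Finset.univ.filter (fun P : Finset (Fin N) × Finset (Fin N) =>
            P.2.card = (B ⟨m - 1, by omega⟩).card ∧ Disjoint P.1 P.2 ∧
            P.1 ∪ P.2 = Finset.univ),
          (zsub P.1 P.2)⁻¹ *
            schur P.1
              (padded (List.ofFn fun j : Fin (m - 1) =>
                List.replicate (B ⟨(j : ℕ), by have := j.isLt; omega⟩).card
                  ((i j : ℤ) - m + 1 + (j : ℤ) +
                    ((B ⟨m - 1, by omega⟩).card : ℤ))).flatten) := by
  set k := (B ⟨m - 1, by omega⟩).card
  set L := (List.ofFn fun j : Fin (m - 1) =>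
    List.replicate (B ⟨(j : ℕ), by have := j.isLt; omega⟩).card
      ((i j : ℤ) - m + 1 + (j : ℤ))).flatten with hL
  have hL' : (List.ofFn fun j : Fin (m - 1) =>
      List.replicate (B ⟨(j : ℕ), by have := j.isLt; omega⟩).card
        ((i j : ℤ) - m + 1 + (j : ℤ) + (k : ℤ))).flatten = L.map (· + (k : ℤ)) := by
    rw [hL, List.map_flatten, List.map_ofFn]
    congr 2
    ext1 j
    simp
  have hlen : L.length + k = N := by
    have hcard : ∑ j, (B j).card = N := by
      rw [← Finset.card_biUnion fun j _ l _ h => hdisj j l h, hcover, Finset.card_fin]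
    obtain ⟨p, rfl⟩ : ∃ p, m = p + 1 := ⟨m - 1, by omega⟩
    rw [Fin.sum_univ_castSucc] at hcard
    rw [← hcard, hL, List.length_flatten, List.map_ofFn, List.sum_ofFn]
    simp only [Function.comp_apply, List.length_replicate]
    rfl
  rw [hL', schur_univ_eq_sum hlen (padded L) (padded (L.map (· + (k : ℤ))))]
  · refine Finset.sum_bij' (fun S _ => (S, Sᶜ)) (fun P _ => P.1) ?_ ?_ ?_ ?_ ?_
    · intro S hS
      have := (Finset.mem_powersetCard.1 hS).2
      simp only [Finset.mem_filter, Finset.mem_univ, true_and, Finset.union_compl, and_true]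
      refine ⟨?_, disjoint_compl_right⟩
      rw [Finset.card_compl, Fintype.card_fin]
      omega
    · rintro ⟨C', C⟩ hP
      simp only [Finset.mem_filter, Finset.mem_univ, true_and] at hP
      have := Finset.card_union_of_disjoint hP.2.1
      rw [hP.2.2, Finset.card_fin] at this
      simp only [Finset.mem_powersetCard, Finset.subset_univ, true_and]
      omega
    · intro S _
      rfl
    · rintro ⟨C', C⟩ hP
      simp only [Finset.mem_filter, Finset.mem_univ, true_and] at hP
      have hc : IsCompl C' C := ⟨hP.2.1, codisjoint_iff.2 hP.2.2⟩
      simp [hc.compl_eq]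
    · intro S _
      rfl
  · intro j hj
    simp [padded, List.getElem?_eq_getElem hj]
  · intro j hj
    exact List.getD_eq_default _ _ hj

end
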